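/- Let m be a positive integer and let G be a finite simple graph with a spanning subgraph T that has m pairwise edge-disjoint spanning trees. Then for every spanning subgraph F of G, there exists a spanning subgraph H of G that has m pairwise edge-disjoint spanning trees and such that for every vertex v, deg_F(v) ≤ deg_H(v) ≤ deg_T(v) + max{0, deg_F(v) − m}. -/

import Mathlib

open scoped Classical

/-- A graph is `m`-tree-connected if it has `m` pairwise edge-disjoint spanning trees. -/
def SimpleGraph.TreeConnected {V : Type*} (G : SimpleGraph V) (m : ℕ) : Prop :=
  ∃ T : Fin m → SimpleGraph V,
    (∀ i, T i ≤ G ∧ (T i).IsTree) ∧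
    ∀ i j, i ≠ j → Disjoint (T i).edgeSet (T j).edgeSet

namespace SimpleGraph

variable {V : Type*}

/-- Adding an edge `uv` to a tree and removing a suitable edge at `v` gives a tree. -/
theorem IsTree.exists_exchange {T : SimpleGraph V} (hT : T.IsTree) {u v : V} (huv : u ≠ v)
    (hn : ¬ T.Adj u v) :
    ∃ w, T.Adj v w ∧ w ≠ u ∧ ((T \ edge v w) ⊔ edge u v).IsTree := by
  obtain ⟨p, hp⟩ := hT.connected.exists_isPath v u
  cases p with
  | nil => exact absurd rfl huv
  | @cons _ w _ h q =>
    rw [Walk.cons_isPath_iff] at hp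
    have hq : (T \ edge v w).Reachable w u := by
      refine ⟨q.transfer _ fun e he ↦ ?_⟩
      have hev : v ∉ e := fun hv ↦ hp.2 (Walk.mem_support_of_mem_edges he hv)
      have heT := q.edges_subset_edgeSet he
      induction e with
      | h x y =>
        simp only [Sym2.mem_iff, not_or, mem_edgeSet] at hev heT
        simp only [mem_edgeSet, sdiff_adj, edge_adj]
        grind
    have hvw : ¬ (T \ edge v w).Reachable v w := by
      have := isAcyclic_iff_forall_adj_isBridge.1 hT.isAcyclic h
      rwa [isBridge_iff] at this
    refine ⟨w, h, fun hw ↦ hn (hw ▸ h.symm), ?_, ?_⟩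
    · have hadj : ∀ x y, T.Adj x y → ((T \ edge v w) ⊔ edge u v).Reachable x y := by
        have hvw' : ((T \ edge v w) ⊔ edge u v).Reachable v w :=
          (Adj.reachable (by simp [edge_adj, huv, huv.symm])).trans (hq.mono le_sup_left).symm
        intro x y hxy
        by_cases hx : (edge v w).Adj x y
        · rw [edge_adj] at hx
          obtain ⟨⟨rfl, rfl⟩ | ⟨rfl, rfl⟩, -⟩ := hx
          exacts [hvw', hvw'.symm]
        · exact Adj.reachable (Or.inl ⟨hxy, hx⟩)
      have := hT.connected.nonempty
      refine ⟨fun x y ↦ ?_⟩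
      obtain ⟨r⟩ := hT.connected x y
      induction r with
      | nil => rfl
      | cons h' _ ih => exact (hadj _ _ h').trans ih
    · exact (hT.isAcyclic.anti sdiff_le).sup_edge_of_not_reachable
        fun hr ↦ hvw (hq.trans hr).symm

theorem TreeConnected.mono {G H : SimpleGraph V} {m : ℕ} (hGH : G ≤ H) (hG : G.TreeConnected m) :
    H.TreeConnected m := by
  obtain ⟨T, hT, hd⟩ := hG
  exact ⟨T, fun i ↦ ⟨(hT i).1.trans hGH, (hT i).2⟩, hd⟩

theorem le_card_of_edge_disjoint {m : ℕ} {T : Fin m → SimpleGraph V}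
    (hd : ∀ i j, i ≠ j → Disjoint (T i).edgeSet (T j).edgeSet) {v : V} {S : Finset V}
    (hS : ∀ i, ∃ w ∈ S, (T i).Adj v w) : m ≤ S.card := by
  choose f hfS hf using hS
  have hinj : Function.Injective f := by
    intro i j hij
    by_contra hne
    exact (disjoint_edgeSet.1 (hd i j hne)).le_bot (show (T i ⊓ T j).Adj v (f i) from
      ⟨hf i, hij ▸ hf j⟩)
  simpa using Finset.card_le_card_of_injOn f (s := Finset.univ) (fun i _ ↦ hfS i) hinj.injOn

theorem TreeConnected.le_degree [Fintype V] {G : SimpleGraph V} {m : ℕ} (hG : G.TreeConnected m)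
    {u v : V} (huv : u ≠ v) : m ≤ G.degree u := by
  obtain ⟨T, hT, hd⟩ := hG
  refine le_card_of_edge_disjoint hd (v := u) fun i ↦ ?_
  obtain ⟨p⟩ := (hT i).2.connected u v
  cases p with
  | nil => exact absurd rfl huv
  | cons h _ => exact ⟨_, by simpa using (hT i).1 h, h⟩

/-- If fewer than `m` edges at `v` go to `S`, then a new edge `uv` can be exchanged
for an edge at `v` not going to `S`, keeping `m`-tree-connectivity. -/
theorem TreeConnected.exists_exchange {H : SimpleGraph V} {m : ℕ} (hH : H.TreeConnected m)
    {u v : V} (huv : u ≠ v) (hn : ¬ H.Adj u v) {S : Finset V} (hS : S.card < m) :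
    ∃ w, H.Adj v w ∧ w ∉ S ∧ w ≠ u ∧ ((H \ edge v w) ⊔ edge u v).TreeConnected m := by
  obtain ⟨T, hT, hd⟩ := hH
  obtain ⟨i, hi⟩ : ∃ i, ∀ w ∈ S, ¬ (T i).Adj v w := by
    by_contra! h
    exact hS.not_ge (le_card_of_edge_disjoint hd h)
  obtain ⟨w, hvw, hwu, hw⟩ := (hT i).2.exists_exchange huv fun h ↦ hn ((hT i).1 h)
  have hdis : ∀ j, j ≠ i → Disjoint (T j) ((T i \ edge v w) ⊔ edge u v) := by
    intro j hj
    refine Disjoint.sup_right ((disjoint_edgeSet.1 (hd j i hj)).mono_right sdiff_le) ?_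
    exact (disjoint_edge _).2 fun h ↦ hn ((hT j).1 h)
  refine ⟨w, (hT i).1 hvw, fun h ↦ hi w h hvw, hwu,
    Function.update T i ((T i \ edge v w) ⊔ edge u v), fun j ↦ ?_, fun j k hjk ↦ ?_⟩
  · by_cases hj : j = i
    · subst hj
      rw [Function.update_self]
      exact ⟨sup_le_sup_right (sdiff_le_sdiff_right (hT j).1) _, hw⟩
    · rw [Function.update_of_ne hj]
      refine ⟨le_sup_of_le_left (le_sdiff.2 ⟨(hT j).1, (disjoint_edge _).2 fun h ↦ ?_⟩), (hT j).2⟩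
      exact (disjoint_edgeSet.1 (hd j i hj)).le_bot (show (T j ⊓ T i).Adj v w from ⟨h, hvw⟩)
  · rw [disjoint_edgeSet]
    by_cases hj : j = i
    · subst hj
      simpa [Function.update_of_ne hjk.symm] using (hdis k hjk.symm).symm
    · by_cases hk : k = i
      · subst hk
        simpa [Function.update_of_ne hj] using hdis j hj
      · simpa [Function.update_of_ne hj, Function.update_of_ne hk] using
          disjoint_edgeSet.1 (hd j k hjk)

section Degree

variable [Fintype V] {G G' : SimpleGraph V} {u v : V}

theorem degree_of_eq_sup_edge (hG : G' = G ⊔ edge u v) (huv : u ≠ v) (hn : ¬ G.Adj u v) (x : V) :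
    G'.degree x = G.degree x + if x = u ∨ x = v then 1 else 0 := by
  replace hG : ∀ a b, G'.Adj a b ↔ (G ⊔ edge u v).Adj a b := by simp [hG]
  have hn' : ¬ G.Adj v u := fun h ↦ hn h.symm
  simp only [← card_neighborFinset_eq_degree]
  by_cases hu : x = u
  · subst hu
    rw [if_pos (Or.inl rfl), ← Finset.card_insert_of_notMem (a := v) (by simpa using hn)]
    congr 1
    ext y
    simp only [mem_neighborFinset, Finset.mem_insert, hG, sup_adj, edge_adj]
    grind
  · by_cases hv : x = v
    · subst hv
      rw [if_pos (Or.inr rfl), ← Finset.card_insert_of_notMem (a := u) (by simpa using hn')]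
      congr 1
      ext y
      simp only [mem_neighborFinset, Finset.mem_insert, hG, sup_adj, edge_adj]
      grind
    · rw [if_neg (by tauto), add_zero]
      congr 1
      ext y
      simp only [mem_neighborFinset, hG, sup_adj, edge_adj]
      grind

theorem degree_add_of_eq_sdiff_edge (hG : G' = G \ edge u v) (h : G.Adj u v) (x : V) :
    G.degree x = G'.degree x + if x = u ∨ x = v then 1 else 0 :=
  degree_of_eq_sup_edge (hG ▸ (sdiff_sup_cancel ((edge_le_iff _).2 (Or.inr h))).symm) h.ne
    (by simp [hG, edge_adj, h.ne]) x

end Degree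

section Factor

variable [Fintype V] {m : ℕ} {T F : SimpleGraph V}

/-- The main result when each edge of `F` outside `T` has an end of `F`-degree at most `m`. -/
theorem TreeConnected.exists_factor_of_forall_adj (hT : T.TreeConnected m)
    (hF : ∀ u v, F.Adj u v → ¬ T.Adj u v → m < F.degree u → F.degree v ≤ m) :
    ∃ H ≤ T ⊔ F, H.TreeConnected m ∧
      ∀ v, F.degree v ≤ H.degree v ∧ H.degree v ≤ T.degree v + (F.degree v - m) := by
  obtain ⟨H, ⟨hle, hTF, hH, hdeg⟩, hmax⟩ := Set.Finite.exists_maximalFor (· ⊓ F)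
    {H : SimpleGraph V | H ≤ T ⊔ F ∧ T ⊓ F ≤ H ∧ H.TreeConnected m ∧
      ∀ v, H.degree v ≤ T.degree v + (F.degree v - m)} (Set.toFinite _)
    ⟨T, le_sup_left, inf_le_left, hT, fun v ↦ Nat.le_add_right _ _⟩
  refine ⟨H, hle, hH, fun u ↦ ⟨?_, hdeg u⟩⟩
  by_contra! hu
  obtain ⟨v, hv, hHv⟩ : ∃ v, F.Adj u v ∧ ¬ H.Adj u v := by
    by_contra! h
    exact hu.not_ge (Finset.card_le_card fun x hx ↦ by
      simp only [mem_neighborFinset] at hx ⊢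
      exact h x hx)
  have hmu := hH.le_degree hv.ne
  have hmT := hT.le_degree hv.ne
  have hFv := hF u v hv (fun h ↦ hHv (hTF ⟨h, hv⟩)) (hmu.trans_lt hu)
  have hvu : u ∈ F.neighborFinset v := by simpa using hv.symm
  obtain ⟨w, hvw, hwS, hwu, hH'⟩ := hH.exists_exchange hv.ne hHv
    (S := (F.neighborFinset v).erase u)
    (by rw [Finset.card_erase_of_mem hvu, card_neighborFinset_eq_degree]
        have : 0 < F.degree v := Finset.card_pos.2 ⟨u, hvu⟩
        omega)
  have hFw : ¬ F.Adj v w := fun h ↦ hwS (by simpa [hwu] using h)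
  have hFdis : Disjoint F (edge v w) := (disjoint_edge _).2 hFw
  have huvF : edge u v ≤ F := (edge_le_iff _).2 (Or.inr hv)
  have hle' : H ⊓ F ≤ (H \ edge v w ⊔ edge u v) ⊓ F :=
    le_inf (le_sup_of_le_left (le_sdiff.2 ⟨inf_le_left, hFdis.mono_left inf_le_right⟩))
      inf_le_right
  have hmem := hmax (j := H \ edge v w ⊔ edge u v)
    ⟨sup_le (sdiff_le.trans hle) (huvF.trans le_sup_right),
      le_sup_of_le_left (le_sdiff.2 ⟨hTF, hFdis.mono_left inf_le_right⟩), hH', fun x ↦ ?_⟩ hle'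
  · exact hHv (hmem (show ((H \ edge v w ⊔ edge u v) ⊓ F).Adj u v from
      ⟨Or.inr ((edge_adj ..).2 ⟨Or.inl ⟨rfl, rfl⟩, hv.ne⟩), hv⟩)).1
  · have h1 := degree_of_eq_sup_edge (G := H \ edge v w) rfl hv.ne (fun h ↦ hHv h.1) x
    have h2 := degree_add_of_eq_sdiff_edge rfl hvw x
    have h3 := hdeg x
    rw [h1]
    by_cases hxu : x = u
    · subst hxu
      rw [if_pos (Or.inl rfl)]
      rw [if_neg (by rintro (h | h); exacts [hv.ne h, hwu h.symm])] at h2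
      omega
    · by_cases hxv : x = v
      · subst hxv
        simp only [true_or, or_true, if_true] at h2 ⊢
        omega
      · rw [if_neg (by tauto)]
        omega

theorem TreeConnected.exists_factor (hT : T.TreeConnected m) (F : SimpleGraph V) :
    ∃ H ≤ T ⊔ F, H.TreeConnected m ∧
      ∀ v, F.degree v ≤ H.degree v ∧ H.degree v ≤ T.degree v + (F.degree v - m) := by
  induction F using WellFoundedLT.induction with
  | ind F ih =>
    by_cases hF : ∀ u v, F.Adj u v → ¬ T.Adj u v → m < F.degree u → F.degree v ≤ m
    · exact hT.exists_factor_of_forall_adj hF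
    push Not at hF
    obtain ⟨u, v, huv, hTuv, hu, hv⟩ := hF
    have hlt : F \ edge u v < F :=
      sdiff_lt ((edge_le_iff _).2 (Or.inr huv)) fun h ↦ by
        have : (edge u v).Adj u v := (edge_adj ..).2 ⟨Or.inl ⟨rfl, rfl⟩, huv.ne⟩
        rw [h] at this
        exact this
    obtain ⟨H, hle, hH, hdeg⟩ := ih _ hlt
    have hHuv : ¬ H.Adj u v := fun h ↦ by
      rcases hle h with h | h
      · exact hTuv h
      · exact h.2 ((edge_adj ..).2 ⟨Or.inl ⟨rfl, rfl⟩, huv.ne⟩)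
    refine ⟨H ⊔ edge u v, sup_le (hle.trans (sup_le_sup_left sdiff_le _))
      (le_sup_of_le_right ((edge_le_iff _).2 (Or.inr huv))), hH.mono le_sup_left, fun x ↦ ?_⟩
    have h1 := degree_of_eq_sup_edge rfl huv.ne hHuv x
    have h2 := degree_add_of_eq_sdiff_edge rfl huv x
    have h3 := hdeg x
    rw [h1]
    by_cases hx : x = u ∨ x = v
    · rw [if_pos hx] at h2 ⊢
      have : m < F.degree x := by rcases hx with rfl | rfl <;> assumption
      omega
    · rw [if_neg hx] at h2 ⊢
      rw [add_zero] at h2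
      rwa [add_zero, h2]

end Factor

end SimpleGraph

/-- If `G` has an `m`-tree-connected spanning subgraph `T`, then for every spanning
subgraph `F` there is an `m`-tree-connected spanning subgraph `H` with
`deg_F(v) ≤ deg_H(v) ≤ deg_T(v) + max {0, deg_F(v) - m}` for every vertex `v`. -/
theorem treeConnected_factor_contains {V : Type*} [Fintype V]
    (m : ℕ) (hm : 0 < m) (G : SimpleGraph V)
    (T : SimpleGraph V) (hTG : T ≤ G) (hT : T.TreeConnected m)
    (F : SimpleGraph V) (hFG : F ≤ G) :
    ∃ H : SimpleGraph V, H ≤ G ∧ H.TreeConnected m ∧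
      ∀ v, F.degree v ≤ H.degree v ∧
        (H.degree v : ℤ) ≤ (T.degree v : ℤ) + max 0 ((F.degree v : ℤ) - m) := by
  obtain ⟨H, hle, hH, hdeg⟩ := hT.exists_factor F
  refine ⟨H, hle.trans (sup_le hTG hFG), hH, fun v ↦ ⟨(hdeg v).1, ?_⟩⟩
  have := (hdeg v).2
  omega
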